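/- Let V(r₁,r₂,r₃) denote the minimal Coulomb energy of three unit point charges on concentric spheres of radii r₁,r₂,r₃, let S be the base-3 digit-shift map, and define G(ε) = 3 ∫₀^{1/3} V(1+εx, 1+ε(2/3−x), 1+ε(2/3+x)) dx and F(ε) = 3 ∫₀^{1/3} V(1+εx, 1+εS(x), 1+εS(S(x))) dx. Then, as ε → 0⁺, F(ε) − G(ε) = −(√3/1080) ε² + O(ε³). In particular, there exists δ > 0 such that F(ε) < G(ε) for all 0 < ε < δ, so the SGS co-motion functions do not minimize the strictly-correlated interaction energy for the shell density ρ_{a,ε} when ε is sufficiently small. -/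

import Mathlib

/-- `V(r₁,r₂,r₃)`: the minimal Coulomb energy of three unit point charges
confined to concentric spheres of radii `r₁, r₂, r₃` in `ℝ³`, i.e. the
infimum of `Σ_{i<j} 1/‖x_i − x_j‖` over `x_i ∈ ℝ³` with `‖x_i‖ = r_i`. -/
noncomputable def V3 (r₁ r₂ r₃ : ℝ) : ℝ :=
  sInf {e : ℝ | ∃ x₁ x₂ x₃ : EuclideanSpace ℝ (Fin 3),
    ‖x₁‖ = r₁ ∧ ‖x₂‖ = r₂ ∧ ‖x₃‖ = r₃ ∧
    e = 1 / ‖x₁ - x₂‖ + 1 / ‖x₁ - x₃‖ + 1 / ‖x₂ - x₃‖}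

/-- The `ℓ`-th digit (for `ℓ ≥ 1`) of the canonical base-`N` expansion of
`x ∈ [0,1)`: `n_ℓ = ⌊x·N^ℓ⌋ mod N`.  The resulting digit sequence is the
unique one that is not eventually equal to `N−1`. -/
noncomputable def digit (N : ℕ) (x : ℝ) (ℓ : ℕ) : ℕ :=
  (⌊x * (N : ℝ) ^ ℓ⌋).toNat % N

/-- The digit-shift map `S(x) = Σ_{ℓ≥1} ℘(n_ℓ)/N^ℓ`, where `℘` raises each
digit by one modulo `N`. -/
noncomputable def shiftMap (N : ℕ) (x : ℝ) : ℝ :=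
  ∑' ℓ : ℕ, (((digit N x (ℓ + 1) + 1) % N : ℕ) : ℝ) / (N : ℝ) ^ (ℓ + 1)

/-- The SGS interaction energy `G(ε) = a·V_ee^SGS[ρ_{a,ε}]`. -/
noncomputable def Gsgs (ε : ℝ) : ℝ :=
  3 * ∫ x in (0:ℝ)..(1/3),
    V3 (1 + ε * x) (1 + ε * (2/3 - x)) (1 + ε * (2/3 + x))

/-- The fractal (FRC) interaction energy `F(ε) = a·V_ee^FRC(a,ε)`. -/
noncomputable def Ffrc (ε : ℝ) : ℝ :=
  3 * ∫ x in (0:ℝ)..(1/3),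
    V3 (1 + ε * x) (1 + ε * shiftMap 3 x) (1 + ε * shiftMap 3 (shiftMap 3 x))

namespace FRC

open Set MeasureTheory Filter Topology

/-- Second order model of the energy. -/
noncomputable def P (ε a b c : ℝ) : ℝ :=
  (1 / √3) * (3 - ε * (a + b + c) + ε ^ 2 * ((a ^ 2 + b ^ 2 + c ^ 2) / 10
    + 3 * (a + b + c) ^ 2 / 10))

lemma tangent_bound (d w : ℝ) (hd : 0 < d) (hw : 0 < w) :
    3 / 2 * w - 1 / 2 * w ^ 3 * d ^ 2 ≤ 1 / d := by
  rw [le_div_iff₀ hd]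
  have h : 0 < w * d := mul_pos hw hd
  nlinarith [mul_nonneg (sq_nonneg (w * d - 1)) (by linarith : 0 ≤ w * d + 2)]

lemma norm_sq3 (x : EuclideanSpace ℝ (Fin 3)) : ‖x‖ ^ 2 = x 0 ^ 2 + x 1 ^ 2 + x 2 ^ 2 := by
  rw [EuclideanSpace.norm_sq_eq]
  simp [Fin.sum_univ_three]

lemma exists_norm (r : ℝ) (hr : 0 ≤ r) : ∃ x : EuclideanSpace ℝ (Fin 3), ‖x‖ = r :=
  ⟨EuclideanSpace.single 0 r, by simp [abs_of_nonneg hr]⟩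

lemma V3_lower (r₁ r₂ r₃ m₁ m₂ m₃ : ℝ) (h1 : 0 ≤ r₁) (h2 : 0 ≤ r₂) (h3 : 0 ≤ r₃)
    (h12 : r₁ ≠ r₂) (h13 : r₁ ≠ r₃) (h23 : r₂ ≠ r₃) (hm1 : 0 < m₁) (hm2 : 0 < m₂) (hm3 : 0 < m₃) :
    3 / 2 * (m₁ * m₂ + m₁ * m₃ + m₂ * m₃) - 1 / 2 * (m₁ ^ 3 + m₂ ^ 3 + m₃ ^ 3) *
      (m₁ ^ 3 * r₁ ^ 2 + m₂ ^ 3 * r₂ ^ 2 + m₃ ^ 3 * r₃ ^ 2) ≤ V3 r₁ r₂ r₃ := by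
  unfold V3
  apply le_csInf
  · obtain ⟨x, hx⟩ := exists_norm r₁ h1
    obtain ⟨y, hy⟩ := exists_norm r₂ h2
    obtain ⟨z, hz⟩ := exists_norm r₃ h3
    exact ⟨_, x, y, z, hx, hy, hz, rfl⟩
  · rintro e ⟨x, y, z, hx, hy, hz, rfl⟩
    have d12 : 0 < ‖x - y‖ := norm_pos_iff.2 (sub_ne_zero.2 (by rintro rfl; exact h12 (hx.symm.trans hy)))
    have d13 : 0 < ‖x - z‖ := norm_pos_iff.2 (sub_ne_zero.2 (by rintro rfl; exact h13 (hx.symm.trans hz)))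
    have d23 : 0 < ‖y - z‖ := norm_pos_iff.2 (sub_ne_zero.2 (by rintro rfl; exact h23 (hy.symm.trans hz)))
    have t12 := tangent_bound _ _ d12 (mul_pos hm1 hm2)
    have t13 := tangent_bound _ _ d13 (mul_pos hm1 hm3)
    have t23 := tangent_bound _ _ d23 (mul_pos hm2 hm3)
    have key : (m₁ * m₂) ^ 3 * ‖x - y‖ ^ 2 + (m₁ * m₃) ^ 3 * ‖x - z‖ ^ 2
        + (m₂ * m₃) ^ 3 * ‖y - z‖ ^ 2 ≤ (m₁ ^ 3 + m₂ ^ 3 + m₃ ^ 3) *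
      (m₁ ^ 3 * r₁ ^ 2 + m₂ ^ 3 * r₂ ^ 2 + m₃ ^ 3 * r₃ ^ 2) := by
      rw [← hx, ← hy, ← hz]
      simp only [norm_sq3, PiLp.sub_apply]
      have q := fun k : Fin 3 => sq_nonneg (m₁ ^ 3 * x k + m₂ ^ 3 * y k + m₃ ^ 3 * z k)
      have q0 := q 0
      have q1 := q 1
      have q2 := q 2
      linarith
    linarith

/-- bound of a continuous function on a box -/
lemma box4 (f : ℝ × ℝ × ℝ × ℝ → ℝ) (hf : Continuous f) (M : ℝ) : ∃ K : ℝ, 0 < K ∧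
    ∀ a b c d : ℝ, |a| ≤ M → |b| ≤ M → |c| ≤ M → |d| ≤ M → |f (a, b, c, d)| ≤ K := by
  have hc : IsCompact (Icc (-M) M ×ˢ Icc (-M) M ×ˢ Icc (-M) M ×ˢ Icc (-M) M : Set (ℝ × ℝ × ℝ × ℝ)) :=
    isCompact_Icc.prod (isCompact_Icc.prod (isCompact_Icc.prod isCompact_Icc))
  obtain ⟨K, hK⟩ := hc.exists_bound_of_continuousOn hf.continuousOn
  refine ⟨|K| + 1, by positivity, fun a b c d ha hb hc hd => ?_⟩
  have := hK (a, b, c, d) ⟨abs_le.1 ha, abs_le.1 hb, abs_le.1 hc, abs_le.1 hd⟩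
  rw [Real.norm_eq_abs] at this
  linarith [le_abs_self K]

lemma box5 (f : ℝ × ℝ × ℝ × ℝ × ℝ → ℝ) (hf : Continuous f) (M : ℝ) : ∃ K : ℝ, 0 < K ∧
    ∀ a b c d e : ℝ, |a| ≤ M → |b| ≤ M → |c| ≤ M → |d| ≤ M → |e| ≤ M →
      |f (a, b, c, d, e)| ≤ K := by
  have hc : IsCompact (Icc (-M) M ×ˢ Icc (-M) M ×ˢ Icc (-M) M ×ˢ Icc (-M) M ×ˢ Icc (-M) M :
      Set (ℝ × ℝ × ℝ × ℝ × ℝ)) :=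
    isCompact_Icc.prod (isCompact_Icc.prod (isCompact_Icc.prod (isCompact_Icc.prod isCompact_Icc)))
  obtain ⟨K, hK⟩ := hc.exists_bound_of_continuousOn hf.continuousOn
  refine ⟨|K| + 1, by positivity, fun a b c d e ha hb hc hd he => ?_⟩
  have := hK (a, b, c, d, e) ⟨abs_le.1 ha, abs_le.1 hb, abs_le.1 hc, abs_le.1 hd, abs_le.1 he⟩
  rw [Real.norm_eq_abs] at this
  linarith [le_abs_self K]

noncomputable def nu (T a : ℝ) : ℝ := -T / 30 - 2 * a / 5

/-- polynomial remainder for the product of two sums -/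
lemma poly_lower : ∃ K : ℝ, 0 < K ∧ ∀ ε a b c : ℝ, |ε| ≤ 1 → |a| ≤ 1 → |b| ≤ 1 → |c| ≤ 1 →
    ∃ R : ℝ, |R| ≤ K ∧ 
    3 / 2 * ((1 + ε * nu (a+b+c) a) * (1 + ε * nu (a+b+c) b) + (1 + ε * nu (a+b+c) a) * (1 + ε * nu (a+b+c) c)
      + (1 + ε * nu (a+b+c) b) * (1 + ε * nu (a+b+c) c))
    - 1 / 6 * ((1 + ε * nu (a+b+c) a) ^ 3 + (1 + ε * nu (a+b+c) b) ^ 3 + (1 + ε * nu (a+b+c) c) ^ 3) *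
      ((1 + ε * nu (a+b+c) a) ^ 3 * (1 + ε * a) ^ 2 + (1 + ε * nu (a+b+c) b) ^ 3 * (1 + ε * b) ^ 2
        + (1 + ε * nu (a+b+c) c) ^ 3 * (1 + ε * c) ^ 2)
    = 3 - ε * (a + b + c) + ε ^ 2 * ((a ^ 2 + b ^ 2 + c ^ 2) / 10
    + 3 * (a + b + c) ^ 2 / 10) + ε ^ 3 * R := by
  let n : ℝ → ℝ → ℝ → ℝ → ℝ := fun a b c x => nu (a+b+c) x
  let A1 : ℝ → ℝ → ℝ → ℝ := fun a b c => 3 * (n a b c a + n a b c b + n a b c c)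
  let A2 : ℝ → ℝ → ℝ → ℝ := fun a b c => 3 * (n a b c a ^ 2 + n a b c b ^ 2 + n a b c c ^ 2)
  let A3 : ℝ → ℝ → ℝ → ℝ := fun a b c => n a b c a ^ 3 + n a b c b ^ 3 + n a b c c ^ 3
  let b1 : ℝ → ℝ → ℝ := fun v a => 3 * v + 2 * a
  let b2 : ℝ → ℝ → ℝ := fun v a => 3 * v ^ 2 + 6 * v * a + a ^ 2
  let b3 : ℝ → ℝ → ℝ → ℝ := fun e v a => v ^ 3 + 6 * v ^ 2 * a + 3 * v * a ^ 2
    + e * (2 * v ^ 3 * a + 3 * v ^ 2 * a ^ 2) + e ^ 2 * v ^ 3 * a ^ 2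
  let B1 : ℝ → ℝ → ℝ → ℝ := fun a b c => b1 (n a b c a) a + b1 (n a b c b) b + b1 (n a b c c) c
  let B2 : ℝ → ℝ → ℝ → ℝ := fun a b c => b2 (n a b c a) a + b2 (n a b c b) b + b2 (n a b c c) c
  let B3 : ℝ → ℝ → ℝ → ℝ → ℝ := fun e a b c =>
    b3 e (n a b c a) a + b3 e (n a b c b) b + b3 e (n a b c c) c
  let R : ℝ × ℝ × ℝ × ℝ → ℝ := fun p =>
    -(1 / 6) * (A1 p.2.1 p.2.2.1 p.2.2.2 * B2 p.2.1 p.2.2.1 p.2.2.2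
      + A2 p.2.1 p.2.2.1 p.2.2.2 * B1 p.2.1 p.2.2.1 p.2.2.2
      + p.1 * A2 p.2.1 p.2.2.1 p.2.2.2 * B2 p.2.1 p.2.2.1 p.2.2.2
      + A3 p.2.1 p.2.2.1 p.2.2.2 * (3 + p.1 * B1 p.2.1 p.2.2.1 p.2.2.2 +
          p.1 ^ 2 * B2 p.2.1 p.2.2.1 p.2.2.2 + p.1 ^ 3 * B3 p.1 p.2.1 p.2.2.1 p.2.2.2)
      + (3 + p.1 * A1 p.2.1 p.2.2.1 p.2.2.2 + p.1 ^ 2 * A2 p.2.1 p.2.2.1 p.2.2.2) *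
          B3 p.1 p.2.1 p.2.2.1 p.2.2.2)
  obtain ⟨K, hK, h⟩ := box4 R (by
    simp only [R, A1, A2, A3, B1, B2, B3, b1, b2, b3, n, nu]; fun_prop) 1
  refine ⟨K, hK, fun ε a b c he ha hb hc => ⟨_, h ε a b c he ha hb hc, ?_⟩⟩
  simp only [R, A1, A2, A3, B1, B2, B3, b1, b2, b3, n, nu]
  ring

lemma nu_pos (ε T a : ℝ) (he : 0 < ε) (he1 : ε < 1) (hT : T ≤ 3) (ha : a ≤ 1) :
    0 < 1 + ε * nu T a := by
  have h : -1 / 2 ≤ nu T a := by unfold nu; linarith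
  have := mul_le_mul_of_nonneg_left h he.le
  linarith

lemma V3_ge : ∃ K : ℝ, 0 < K ∧ ∀ ε a b c : ℝ, 0 < ε → ε < 1 → a ∈ Icc (0:ℝ) 1 → b ∈ Icc (0:ℝ) 1 →
    c ∈ Icc (0:ℝ) 1 → a ≠ b → a ≠ c → b ≠ c →
    P ε a b c - K * ε ^ 3 ≤ V3 (1 + ε * a) (1 + ε * b) (1 + ε * c) := by
  obtain ⟨K, hK, h⟩ := poly_lower
  refine ⟨K, hK, fun ε a b c he he1 ha hb hc hab hac hbc => ?_⟩
  obtain ⟨R, hR, hE⟩ := h ε a b c (abs_le.2 ⟨by linarith, he1.le⟩) (abs_le.2 ⟨by linarith [ha.1], ha.2⟩)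
    (abs_le.2 ⟨by linarith [hb.1], hb.2⟩) (abs_le.2 ⟨by linarith [hc.1], hc.2⟩)
  have s3 : 0 < √3 := by positivity
  set m := √(1 / √3) with hm
  have hm0 : 0 < m := by positivity
  have hm2 : m ^ 2 = 1 / √3 := Real.sq_sqrt (by positivity)
  have hm6 : m ^ 6 = 1 / √3 * (1 / 3) := by
    have h33 : √3 ^ 2 = 3 := Real.sq_sqrt (by norm_num)
    calc m ^ 6 = (m ^ 2) ^ 3 := by ring
      _ = 1 / √3 * (1 / √3 ^ 2) := by rw [hm2]; ring
      _ = _ := by rw [h33]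
  have ea : 0 < 1 + ε * nu (a+b+c) a := nu_pos _ _ _ he he1
    (by linarith [ha.2, hb.2, hc.2]) ha.2
  have eb : 0 < 1 + ε * nu (a+b+c) b := nu_pos _ _ _ he he1
    (by linarith [ha.2, hb.2, hc.2]) hb.2
  have ec : 0 < 1 + ε * nu (a+b+c) c := nu_pos _ _ _ he he1
    (by linarith [ha.2, hb.2, hc.2]) hc.2
  have nd : ∀ x y : ℝ, x ≠ y → 1 + ε * x ≠ 1 + ε * y := fun x y hxy hh =>
    hxy (mul_left_cancel₀ he.ne' (add_left_cancel hh))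
  have L := V3_lower (1 + ε * a) (1 + ε * b) (1 + ε * c) _ _ _
    (by have := mul_nonneg he.le ha.1; linarith) (by have := mul_nonneg he.le hb.1; linarith)
    (by have := mul_nonneg he.le hc.1; linarith) (nd _ _ hab) (nd _ _ hac) (nd _ _ hbc)
    (mul_pos hm0 ea) (mul_pos hm0 eb) (mul_pos hm0 ec)
  refine le_trans ?_ L
  generalize 1 + ε * nu (a+b+c) a = x at *
  generalize 1 + ε * nu (a+b+c) b = y at *
  generalize 1 + ε * nu (a+b+c) c = z at *
  have e1 : 3 / 2 * (m * x * (m * y) + m * x * (m * z) + m * y * (m * z)) -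
    1 / 2 * ((m * x) ^ 3 + (m * y) ^ 3 + (m * z) ^ 3) *
      ((m * x) ^ 3 * (1 + ε * a) ^ 2 + (m * y) ^ 3 * (1 + ε * b) ^ 2 + (m * z) ^ 3 * (1 + ε * c) ^ 2)
      = m ^ 2 * (3 / 2 * (x * y + x * z + y * z)) - m ^ 6 * (1 / 2 * (x ^ 3 + y ^ 3 + z ^ 3) *
      (x ^ 3 * (1 + ε * a) ^ 2 + y ^ 3 * (1 + ε * b) ^ 2 + z ^ 3 * (1 + ε * c) ^ 2)) := by ring
  have e2 : m ^ 2 * (3 / 2 * (x * y + x * z + y * z)) - m ^ 6 * (1 / 2 * (x ^ 3 + y ^ 3 + z ^ 3) *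
      (x ^ 3 * (1 + ε * a) ^ 2 + y ^ 3 * (1 + ε * b) ^ 2 + z ^ 3 * (1 + ε * c) ^ 2))
      = P ε a b c + (1 / √3) * (ε ^ 3 * R) := by
    rw [hm2, hm6]; unfold P
    linear_combination (1 / √3) * hE
  rw [e1, e2]
  have hs1 : 1 / √3 ≤ 1 := by
    rw [div_le_one s3]; exact Real.one_le_sqrt.2 (by norm_num)
  have hs0 : 0 ≤ 1 / √3 := by positivity
  have he3 : 0 < ε ^ 3 := by positivity
  have : -(K) ≤ 1 / √3 * R := by
    have := abs_le.1 hR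
    have h1 : |1 / √3 * R| ≤ 1 * K := by
      rw [abs_mul, abs_of_nonneg hs0]; gcongr
    have := (abs_le.1 h1).1
    linarith
  nlinarith

lemma inv_sqrt_bound (h : ℝ) (hh : |h| ≤ 1 / 2) :
    1 / √(1 + h) ≤ 1 - h / 2 + 3 * h ^ 2 / 8 + |h| ^ 3 := by
  obtain ⟨l, u⟩ := abs_le.1 hh
  have h1 : 0 < 1 + h := by linarith
  have hs : 0 < √(1 + h) := Real.sqrt_pos.2 h1
  rw [div_le_iff₀ hs]
  have hQ : 0 ≤ 1 - h / 2 + 3 * h ^ 2 / 8 + |h| ^ 3 := by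
    have : 0 ≤ |h| ^ 3 := by positivity
    nlinarith [sq_nonneg h]
  rw [← Real.sqrt_sq hQ, ← Real.sqrt_mul (sq_nonneg _), Real.one_le_sqrt]
  rcases le_or_gt 0 h with h0 | h0
  · rw [abs_of_nonneg h0]
    have k : (1 - h / 2 + 3 * h ^ 2 / 8 + h ^ 3) ^ 2 * (1 + h) - 1 = 
      h ^ 3 * (5/8 + 2 - 15/64*h + 9/64 * h^2 + h - h^2/4 + 3/4*h^3 + h^3 + h ^ 4) := by ring
    have : 0 ≤ h ^ 3 * (5/8 + 2 - 15/64*h + 9/64 * h^2 + h - h^2/4 + 3/4*h^3 + h^3 + h ^ 4) := by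
      apply mul_nonneg (by positivity)
      have : 0 ≤ h ^ 3 := by positivity
      nlinarith [sq_nonneg (h^2)]
    linarith
  · rw [abs_of_neg h0]
    obtain ⟨g, rfl⟩ : ∃ g, h = -g := ⟨-h, by ring⟩
    simp only [neg_neg]
    have g0 : 0 < g := by linarith
    have g1 : g ≤ 1 / 2 := by linarith
    have h3 : 1 ≤ (1 + g / 2 + 3 * g ^ 2 / 8 + g ^ 3) ^ 2 * (1 - g) := by
      have : 0 ≤ g ^ 3 * (1 - 2 * g) := mul_nonneg (by positivity) (by linarith)
      have : 0 ≤ g ^ 4 * (1 - 2 * g) := mul_nonneg (by positivity) (by linarith)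
      have : 0 ≤ g ^ 5 * (1 - 2 * g) := mul_nonneg (by positivity) (by linarith)
      have : 0 ≤ g ^ 6 * (1 - 2 * g) := mul_nonneg (by positivity) (by linarith)
      have : 0 < g ^ 3 := by positivity
      nlinarith
    have e4 : (1 - -g / 2 + 3 * (-g) ^ 2 / 8 + g ^ 3) ^ 2 * (1 + -g)
        = (1 + g / 2 + 3 * g ^ 2 / 8 + g ^ 3) ^ 2 * (1 - g) := by ring
    rw [e4]
    exact h3

lemma cos_expand (ε e : ℝ) (he : 0 < ε) (he1 : ε ≤ 1 / 2) (hee : |e| ≤ 1) :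
    ∃ ρ : ℝ, |ρ| ≤ 20 ∧ Real.cos (2 * Real.pi / 3 + √3 * ε * e) =
      -1 / 2 - 3 / 2 * (ε * e) + 3 / 4 * (ε * e) ^ 2 + ε ^ 3 * ρ := by
  have s2 : √3 ^ 2 = 3 := Real.sq_sqrt (by norm_num)
  have s0 : 0 < √3 := by positivity
  have sle : √3 < 2 := by nlinarith
  set d := √3 * ε * e with hd
  have hda : |d| ≤ 2 * ε := by
    rw [hd, abs_mul, abs_mul, abs_of_pos s0, abs_of_pos he]
    calc √3 * ε * |e| ≤ 2 * ε * 1 := by gcongr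
      _ = _ := by ring
  have hd1 : |d| ≤ 1 := by linarith
  have hc := Real.cos_bound hd1
  have hs := Real.sin_bound hd1
  have hd3 : |d| ^ 3 ≤ 8 * ε ^ 3 := by
    calc |d| ^ 3 ≤ (2 * ε) ^ 3 := by gcongr
      _ = _ := by ring
  have hd4 : |d| ^ 4 ≤ 8 * ε ^ 3 := by
    calc |d| ^ 4 = |d| ^ 3 * |d| := by ring
      _ ≤ |d| ^ 3 * 1 := by gcongr
      _ ≤ _ := by linarith
  have hd5 : |d| ^ 5 ≤ 8 * ε ^ 3 := by
    calc |d| ^ 5 = |d| ^ 4 * |d| := by ring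
      _ ≤ |d| ^ 4 * 1 := by gcongr
      _ ≤ _ := by linarith
  have hd3' : |d ^ 3| ≤ 8 * ε ^ 3 := by rwa [abs_pow]
  have e3 : 0 < ε ^ 3 := by positivity
  have c23 : Real.cos (2 * Real.pi / 3) = -1 / 2 := by
    rw [show 2 * Real.pi / 3 = Real.pi - Real.pi / 3 by ring, Real.cos_pi_sub, Real.cos_pi_div_three]
    norm_num
  have s23 : Real.sin (2 * Real.pi / 3) = √3 / 2 := by
    rw [show 2 * Real.pi / 3 = Real.pi - Real.pi / 3 by ring, Real.sin_pi_sub, Real.sin_pi_div_three]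
  set u := Real.cos d - (1 - d ^ 2 / 2) with hu
  set v := Real.sin d - d with hv
  have hub : |u| ≤ 8 * ε ^ 3 := by linarith [abs_nonneg d]
  have hvb : |v| ≤ 16 * ε ^ 3 := by
    rw [abs_le] at hs hd3' ⊢
    constructor <;> linarith [hs.1, hs.2, hd3'.1, hd3'.2]
  have hsv : |√3 / 2 * v| ≤ 16 * ε ^ 3 := by
    rw [abs_mul, abs_of_pos (by positivity : 0 < √3 / 2)]
    calc √3 / 2 * |v| ≤ 1 * (16 * ε ^ 3) := by gcongr; linarith
      _ = _ := by ring
  refine ⟨(-1 / 2 * u - √3 / 2 * v) / ε ^ 3, ?_, ?_⟩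
  · rw [abs_div, abs_of_pos e3, div_le_iff₀ e3]
    rw [abs_le] at *
    constructor <;> linarith [hub.1, hub.2, hsv.1, hsv.2]
  · rw [mul_div_cancel₀ _ e3.ne', Real.cos_add, c23, s23]
    have : Real.cos d = 1 - d ^ 2 / 2 + u := by rw [hu]; ring
    rw [this]
    have : Real.sin d = d + v := by rw [hv]; ring
    rw [this, hd]
    linear_combination (-ε * e / 2 + ε ^ 2 * e ^ 2 / 4) * s2

noncomputable def H1 (a b e : ℝ) : ℝ := a + b + e
noncomputable def H2 (a b e : ℝ) : ℝ :=
  1 / 3 * (a ^ 2 + b ^ 2 + a * b + 3 * e * (a + b) - 3 / 2 * e ^ 2)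

lemma pair_upper : ∃ K δ : ℝ, 0 < K ∧ 0 < δ ∧ ∀ ε a b e : ℝ, 0 < ε → ε < δ → |a| ≤ 1 → |b| ≤ 1 →
    |e| ≤ 1 → 1 / √((1 + ε * a) ^ 2 + (1 + ε * b) ^ 2 - 2 * (1 + ε * a) * (1 + ε * b) *
      Real.cos (2 * Real.pi / 3 + √3 * ε * e)) ≤
      1 / √3 * (1 - ε * H1 a b e / 2 + ε ^ 2 * (3 * H1 a b e ^ 2 / 8 - H2 a b e / 2)) + K * ε ^ 3 := by
  let H3 : ℝ × ℝ × ℝ × ℝ × ℝ → ℝ := fun p =>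
    -(2 / 3) * ((p.2.1 + p.2.2.1) * (3 / 4) * p.2.2.2.1 ^ 2 + p.2.1 * p.2.2.1 * (-3 / 2) * p.2.2.2.1
      + p.1 * p.2.1 * p.2.2.1 * (3 / 4) * p.2.2.2.1 ^ 2
      + (1 + p.1 * p.2.1) * (1 + p.1 * p.2.2.1) * p.2.2.2.2)
  let k : ℝ × ℝ × ℝ × ℝ × ℝ → ℝ := fun p =>
    H1 p.2.1 p.2.2.1 p.2.2.2.1 + p.1 * H2 p.2.1 p.2.2.1 p.2.2.2.1 + p.1 ^ 2 * H3 p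
  let R : ℝ × ℝ × ℝ × ℝ × ℝ → ℝ := fun p =>
    -(H3 p) / 2 + 3 / 8 * ((H2 p.2.1 p.2.2.1 p.2.2.2.1 + p.1 * H3 p) *
      (2 * H1 p.2.1 p.2.2.1 p.2.2.2.1 + p.1 * H2 p.2.1 p.2.2.1 p.2.2.2.1 + p.1 ^ 2 * H3 p))
      + |k p| ^ 3
  have cH3 : Continuous H3 := by simp only [H3]; fun_prop
  have ck : Continuous k := by simp only [k, H1, H2]; fun_prop
  have cR : Continuous R := by simp only [R, H1, H2]; fun_prop
  obtain ⟨K1, hK1, hk⟩ := box5 k ck 20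
  obtain ⟨K2, hK2, hR⟩ := box5 R cR 20
  refine ⟨K2, min (1 / 2) (1 / (2 * K1)), hK2, by positivity, fun ε a b e he hlt ha hb hee => ?_⟩
  have he1 : ε < 1 / 2 := lt_of_lt_of_le hlt (min_le_left _ _)
  have he2 : ε < 1 / (2 * K1) := lt_of_lt_of_le hlt (min_le_right _ _)
  obtain ⟨ρ, hρ, hcos⟩ := cos_expand ε e he he1.le hee
  have hea : |ε| ≤ 20 := by rw [abs_of_pos he]; linarith
  have hk' := hk ε a b e ρ hea (by linarith) (by linarith) (by linarith) hρ
  have hR' := hR ε a b e ρ hea (by linarith) (by linarith) (by linarith) hρ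
  have hs : (1 + ε * a) ^ 2 + (1 + ε * b) ^ 2 - 2 * (1 + ε * a) * (1 + ε * b) *
      Real.cos (2 * Real.pi / 3 + √3 * ε * e) = 3 * (1 + ε * k (ε, a, b, e, ρ)) := by
    rw [hcos]
    simp only [k, H1, H2, H3]
    ring
  rw [hs, Real.sqrt_mul (by norm_num), ← one_div_mul_one_div]
  have hh : |ε * k (ε, a, b, e, ρ)| ≤ 1 / 2 := by
    rw [abs_mul, abs_of_pos he]
    calc ε * |k (ε, a, b, e, ρ)| ≤ 1 / (2 * K1) * K1 := by gcongr
      _ = 1 / 2 := by field_simp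
  have hb := inv_sqrt_bound _ hh
  have hs0 : 0 ≤ 1 / √3 := by positivity
  have hs1 : 1 / √3 ≤ 1 := by
    rw [div_le_one (by positivity)]; exact Real.one_le_sqrt.2 (by norm_num)
  have hid : 1 - ε * k (ε, a, b, e, ρ) / 2 + 3 * (ε * k (ε, a, b, e, ρ)) ^ 2 / 8
      + |ε * k (ε, a, b, e, ρ)| ^ 3 = 
      1 - ε * H1 a b e / 2 + ε ^ 2 * (3 * H1 a b e ^ 2 / 8 - H2 a b e / 2)
      + ε ^ 3 * R (ε, a, b, e, ρ) := by
    rw [abs_mul, abs_of_pos he]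
    simp only [R]
    generalize |k (ε, a, b, e, ρ)| = q
    simp only [k]
    generalize H3 (ε, a, b, e, ρ) = h3
    ring
  rw [hid] at hb
  calc _ ≤ 1 / √3 * (1 - ε * H1 a b e / 2 + ε ^ 2 * (3 * H1 a b e ^ 2 / 8 - H2 a b e / 2)
      + ε ^ 3 * R (ε, a, b, e, ρ)) := by gcongr
    _ = 1 / √3 * (1 - ε * H1 a b e / 2 + ε ^ 2 * (3 * H1 a b e ^ 2 / 8 - H2 a b e / 2))
      + 1 / √3 * (ε ^ 3 * R (ε, a, b, e, ρ)) := by ring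
    _ ≤ _ := by
      have h1 : 1 / √3 * (ε ^ 3 * R (ε, a, b, e, ρ)) ≤ 1 * (ε ^ 3 * K2) := by
        calc _ ≤ 1 / √3 * (ε ^ 3 * K2) := by gcongr; exact (le_abs_self _).trans hR'
          _ ≤ _ := by gcongr
      linarith

/-- planar vector in polar coordinates -/
noncomputable def pol (r t : ℝ) : EuclideanSpace ℝ (Fin 3) := !₂[r * Real.cos t, r * Real.sin t, 0]

lemma pol_norm (r t : ℝ) (hr : 0 ≤ r) : ‖pol r t‖ = r := by
  have h : ‖pol r t‖ ^ 2 = r ^ 2 := by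
    rw [norm_sq3]; simp [pol]
    linear_combination r ^ 2 * Real.sin_sq_add_cos_sq t
  exact (pow_left_inj₀ (norm_nonneg _) hr two_ne_zero).1 h

lemma pol_dist (r t s u : ℝ) :
    ‖pol r t - pol s u‖ = √(r ^ 2 + s ^ 2 - 2 * r * s * Real.cos (t - u)) := by
  rw [← Real.sqrt_sq (norm_nonneg (pol r t - pol s u))]
  congr 1
  rw [norm_sq3, Real.cos_sub]; simp [pol]
  linear_combination r ^ 2 * Real.sin_sq_add_cos_sq t + s ^ 2 * Real.sin_sq_add_cos_sq u

lemma V3_bdd (r₁ r₂ r₃ : ℝ) : BddBelow {e : ℝ | ∃ x₁ x₂ x₃ : EuclideanSpace ℝ (Fin 3),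
    ‖x₁‖ = r₁ ∧ ‖x₂‖ = r₂ ∧ ‖x₃‖ = r₃ ∧
    e = 1 / ‖x₁ - x₂‖ + 1 / ‖x₁ - x₃‖ + 1 / ‖x₂ - x₃‖} := by
  refine ⟨0, ?_⟩
  rintro e ⟨x, y, z, -, -, -, rfl⟩
  positivity

lemma V3_le_of (x y z : EuclideanSpace ℝ (Fin 3)) :
    V3 ‖x‖ ‖y‖ ‖z‖ ≤ 1 / ‖x - y‖ + 1 / ‖x - z‖ + 1 / ‖y - z‖ :=
  csInf_le (V3_bdd _ _ _) ⟨x, y, z, rfl, rfl, rfl, rfl⟩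

lemma V3_upper : ∃ K δ : ℝ, 0 < K ∧ 0 < δ ∧ ∀ ε a b c : ℝ, 0 < ε → ε < δ → a ∈ Icc (0:ℝ) 1 →
    b ∈ Icc (0:ℝ) 1 → c ∈ Icc (0:ℝ) 1 →
    V3 (1 + ε * a) (1 + ε * b) (1 + ε * c) ≤ P ε a b c + K * ε ^ 3 := by
  obtain ⟨K, δ, hK, hδ, h⟩ := pair_upper
  refine ⟨3 * K, δ, by positivity, hδ, fun ε a b c he hlt ha hb hc => ?_⟩
  set m := (a + b + c) / 3 with hm
  have hA : |a| ≤ 1 := abs_le.2 ⟨by linarith [ha.1], ha.2⟩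
  have hB : |b| ≤ 1 := abs_le.2 ⟨by linarith [hb.1], hb.2⟩
  have hC : |c| ≤ 1 := abs_le.2 ⟨by linarith [hc.1], hc.2⟩
  have bd : ∀ x ∈ Icc (0:ℝ) 1, |(x - m) / 5| ≤ 1 := fun x hx => by
    rw [abs_le]; constructor <;> linarith [ha.1, ha.2, hb.1, hb.2, hc.1, hc.2, hx.1, hx.2]
  have h12 := h ε a b ((c - m) / 5) he hlt hA hB (bd c hc)
  have h13 := h ε a c ((b - m) / 5) he hlt hA hC (bd b hb)
  have h23 := h ε b c ((a - m) / 5) he hlt hB hC (bd a ha)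
  have n : ∀ x ∈ Icc (0:ℝ) 1, 0 ≤ 1 + ε * x := fun x hx => by
    have := mul_nonneg he.le hx.1; linarith
  have L := V3_le_of (pol (1 + ε * a) 0) (pol (1 + ε * b) (-(2 * Real.pi / 3 + √3 * ε * ((c - m) / 5))))
    (pol (1 + ε * c) (2 * Real.pi / 3 + √3 * ε * ((b - m) / 5)))
  rw [pol_norm _ _ (n a ha), pol_norm _ _ (n b hb), pol_norm _ _ (n c hc), pol_dist, pol_dist, pol_dist]
    at L
  have c1 : Real.cos (0 - -(2 * Real.pi / 3 + √3 * ε * ((c - m) / 5)))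
      = Real.cos (2 * Real.pi / 3 + √3 * ε * ((c - m) / 5)) := by congr 1; ring
  have c2 : Real.cos (0 - (2 * Real.pi / 3 + √3 * ε * ((b - m) / 5)))
      = Real.cos (2 * Real.pi / 3 + √3 * ε * ((b - m) / 5)) := by rw [zero_sub, Real.cos_neg]
  have c3 : Real.cos (-(2 * Real.pi / 3 + √3 * ε * ((c - m) / 5)) - 
        (2 * Real.pi / 3 + √3 * ε * ((b - m) / 5)))
      = Real.cos (2 * Real.pi / 3 + √3 * ε * ((a - m) / 5)) := by
    rw [← Real.cos_sub_two_pi (2 * Real.pi / 3 + √3 * ε * ((a - m) / 5))]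
    congr 1; rw [hm]; ring
  rw [c1, c2, c3] at L
  have e : P ε a b c = 
    1 / √3 * (1 - ε * H1 a b ((c - m) / 5) / 2 + ε ^ 2 * (3 * H1 a b ((c - m) / 5) ^ 2 / 8 - H2 a b ((c - m) / 5) / 2))
    + 1 / √3 * (1 - ε * H1 a c ((b - m) / 5) / 2 + ε ^ 2 * (3 * H1 a c ((b - m) / 5) ^ 2 / 8 - H2 a c ((b - m) / 5) / 2))
    + 1 / √3 * (1 - ε * H1 b c ((a - m) / 5) / 2 + ε ^ 2 * (3 * H1 b c ((a - m) / 5) ^ 2 / 8 - H2 b c ((a - m) / 5) / 2)) := by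
    simp only [P, H1, H2, hm]; ring
  rw [e]
  linarith

lemma V3_expand : ∃ K δ : ℝ, 0 < K ∧ 0 < δ ∧ ∀ ε a b c : ℝ, 0 < ε → ε < δ → a ∈ Icc (0:ℝ) 1 →
    b ∈ Icc (0:ℝ) 1 → c ∈ Icc (0:ℝ) 1 → a ≠ b → a ≠ c → b ≠ c →
    |V3 (1 + ε * a) (1 + ε * b) (1 + ε * c) - P ε a b c| ≤ K * ε ^ 3 := by
  obtain ⟨K, hK, h⟩ := V3_ge
  obtain ⟨K', δ, hK', hδ, h'⟩ := V3_upper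
  refine ⟨K + K', min 1 δ, by positivity, by positivity,
    fun ε a b c he hlt ha hb hc hab hac hbc => ?_⟩
  have h1 := h ε a b c he (lt_of_lt_of_le hlt (min_le_left _ _)) ha hb hc hab hac hbc
  have h2 := h' ε a b c he (lt_of_lt_of_le hlt (min_le_right _ _)) ha hb hc
  have e3 : 0 < ε ^ 3 := by positivity
  have := mul_pos hK e3
  have := mul_pos hK' e3
  rw [abs_le]; constructor <;> linarith

/-- digit rotation by `j` -/
noncomputable def Sh (j : ℕ) (x : ℝ) : ℝ :=
  ∑' ℓ : ℕ, (((digit 3 x (ℓ + 1) + j) % 3 : ℕ) : ℝ) / ((3 : ℕ) : ℝ) ^ (ℓ + 1)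

lemma shift_eq (x : ℝ) : shiftMap 3 x = Sh 1 x := rfl

lemma hasSum_geo (c : ℝ) : HasSum (fun ℓ : ℕ => c / ((3 : ℕ) : ℝ) ^ (ℓ + 1)) (c / 2) := by
  have h := (hasSum_geometric_of_lt_one (r := (1 / 3 : ℝ)) (by norm_num) (by norm_num)).mul_left (c / 3)
  have e1 : (fun ℓ : ℕ => c / ((3 : ℕ) : ℝ) ^ (ℓ + 1)) = fun i : ℕ => c / 3 * (1 / 3) ^ i := by
    funext ℓ
    push_cast
    rw [one_div, inv_pow, pow_succ]
    field_simp
  have e2 : c / 2 = c / 3 * (1 - 1 / 3)⁻¹ := by norm_num; ring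
  rw [e1, e2]
  exact h

lemma Sh_summable (j : ℕ) (x : ℝ) :
    Summable (fun ℓ : ℕ => (((digit 3 x (ℓ + 1) + j) % 3 : ℕ) : ℝ) / ((3 : ℕ) : ℝ) ^ (ℓ + 1)) := by
  refine Summable.of_nonneg_of_le (fun ℓ => by positivity) (fun ℓ => ?_) (hasSum_geo 2).summable
  have h : (digit 3 x (ℓ + 1) + j) % 3 ≤ 2 := by omega
  have h' : (((digit 3 x (ℓ + 1) + j) % 3 : ℕ) : ℝ) ≤ 2 := by exact_mod_cast h
  gcongr

lemma Sh_nonneg (j : ℕ) (x : ℝ) : 0 ≤ Sh j x := tsum_nonneg fun ℓ => by positivity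

lemma Sh_le_one (j : ℕ) (x : ℝ) : Sh j x ≤ 1 := by
  have h2 : HasSum (fun ℓ : ℕ => (2 : ℝ) / ((3 : ℕ) : ℝ) ^ (ℓ + 1)) 1 := by
    simpa using hasSum_geo 2
  refine hasSum_le (fun ℓ => ?_) (Sh_summable j x).hasSum h2
  have h : (digit 3 x (ℓ + 1) + j) % 3 ≤ 2 := by omega
  have h' : (((digit 3 x (ℓ + 1) + j) % 3 : ℕ) : ℝ) ≤ 2 := by exact_mod_cast h
  gcongr

lemma digit_fract (x : ℝ) (hx : 0 ≤ x) (ℓ : ℕ) :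
    digit 3 (Int.fract (3 * x)) (ℓ + 1) = digit 3 x (ℓ + 2) := by
  unfold digit
  have e : Int.fract (3 * x) * ((3 : ℕ) : ℝ) ^ (ℓ + 1)
      = x * ((3 : ℕ) : ℝ) ^ (ℓ + 2) - ((3 * (⌊3 * x⌋ * 3 ^ ℓ) : ℤ) : ℝ) := by
    rw [Int.fract]; push_cast; ring
  have h1 : 0 ≤ ⌊Int.fract (3 * x) * ((3 : ℕ) : ℝ) ^ (ℓ + 1)⌋ :=
    Int.floor_nonneg.2 (mul_nonneg (Int.fract_nonneg _) (by positivity))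
  have h2 : 0 ≤ ⌊x * ((3 : ℕ) : ℝ) ^ (ℓ + 2)⌋ := Int.floor_nonneg.2 (by positivity)
  rw [e, Int.floor_sub_intCast] at h1
  rw [e, Int.floor_sub_intCast]
  generalize ⌊3 * x⌋ * 3 ^ ℓ = q at *
  omega

lemma Sh_rec (j : ℕ) (x : ℝ) (hx : 0 ≤ x) :
    Sh j x = (((digit 3 x 1 + j) % 3 : ℕ) : ℝ) / 3 + Sh j (Int.fract (3 * x)) / 3 := by
  unfold Sh
  rw [(Sh_summable j x).tsum_eq_zero_add, ← tsum_div_const]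
  congr 1
  · simp
  · congr 1
    funext ℓ
    rw [digit_fract x hx, pow_succ _ (ℓ + 1), div_mul_eq_div_div]
    norm_num

lemma digit_one (k : ℕ) (hk : k < 3) (y : ℝ) (hy : y ∈ Ico (0:ℝ) 1) :
    digit 3 ((k + y) / 3) 1 = k := by
  unfold digit
  have : ⌊((k : ℝ) + y) / 3 * ((3 : ℕ) : ℝ) ^ 1⌋ = (k : ℤ) := by
    rw [Int.floor_eq_iff]
    push_cast
    constructor <;> linarith [hy.1, hy.2]
  rw [this]
  simp
  omega

lemma fract_aff (k : ℕ) (y : ℝ) (hy : y ∈ Ico (0:ℝ) 1) :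
    Int.fract (3 * (((k : ℝ) + y) / 3)) = y := by
  rw [show 3 * (((k : ℝ) + y) / 3) = (k : ℝ) + y by ring, Int.fract_natCast_add]
  exact Int.fract_eq_self.2 hy

lemma Sh_aff (j k : ℕ) (hk : k < 3) (y : ℝ) (hy : y ∈ Ico (0:ℝ) 1) :
    Sh j ((k + y) / 3) = (((k + j) % 3 : ℕ) : ℝ) / 3 + Sh j y / 3 := by
  rw [Sh_rec j _ (by have := hy.1; positivity), digit_one k hk y hy, fract_aff k y hy]

lemma exists_aff (x : ℝ) (hx : x ∈ Ico (0:ℝ) 1) :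
    ∃ k : ℕ, k < 3 ∧ x = ((k : ℝ) + Int.fract (3 * x)) / 3 := by
  have h0 : 0 ≤ ⌊3 * x⌋ := Int.floor_nonneg.2 (by linarith [hx.1])
  obtain ⟨k, hk⟩ := Int.eq_ofNat_of_zero_le h0
  refine ⟨k, ?_, ?_⟩
  · have : ⌊3 * x⌋ < 3 := Int.floor_lt.2 (by push_cast; linarith [hx.2])
    omega
  · rw [Int.fract, hk]; push_cast; ring

lemma fract_mem (x : ℝ) : Int.fract x ∈ Ico (0:ℝ) 1 := ⟨Int.fract_nonneg x, Int.fract_lt_one x⟩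

lemma Sh_zero (x : ℝ) (hx : x ∈ Ico (0:ℝ) 1) : Sh 0 x = x := by
  have key : ∀ n : ℕ, ∀ x ∈ Ico (0:ℝ) 1, |Sh 0 x - x| ≤ (1 / 3 : ℝ) ^ n := by
    intro n
    induction n with
    | zero =>
      intro x hx
      rw [abs_le]
      constructor <;> linarith [hx.1, hx.2, Sh_nonneg 0 x, Sh_le_one 0 x]
    | succ n ih =>
      intro x hx
      obtain ⟨k, hk, hxk⟩ := exists_aff x hx
      have hi := ih _ (fract_mem (3 * x))
      have e : Sh 0 x - x = (Sh 0 (Int.fract (3 * x)) - Int.fract (3 * x)) * (1 / 3) := by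
        have h1 : Sh 0 x = (((k + 0) % 3 : ℕ) : ℝ) / 3 + Sh 0 (Int.fract (3 * x)) / 3 := by
          conv_lhs => rw [hxk]
          exact Sh_aff 0 k hk _ (fract_mem _)
        rw [add_zero, Nat.mod_eq_of_lt hk] at h1
        rw [h1]
        linarith
      rw [e, abs_mul, pow_succ, abs_of_pos (by norm_num : (0:ℝ) < 1 / 3)]
      gcongr
  have ht : Tendsto (fun n : ℕ => (1 / 3 : ℝ) ^ n) atTop (𝓝 0) :=
    tendsto_pow_atTop_nhds_zero_of_lt_one (by norm_num) (by norm_num)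
  have h0 : |Sh 0 x - x| ≤ 0 := ge_of_tendsto' ht fun n => key n x hx
  have := abs_eq_zero.1 (le_antisymm h0 (abs_nonneg _))
  linarith

lemma Sh_sum (x : ℝ) : Sh 0 x + Sh 1 x + Sh 2 x = 3 / 2 := by
  refine HasSum.unique (((Sh_summable 0 x).hasSum.add (Sh_summable 1 x).hasSum).add
    (Sh_summable 2 x).hasSum) ?_
  convert hasSum_geo 3 using 1
  funext ℓ
  rw [← add_div, ← add_div]
  congr 1
  have : (digit 3 x (ℓ + 1) + 0) % 3 + (digit 3 x (ℓ + 1) + 1) % 3 + (digit 3 x (ℓ + 1) + 2) % 3 = 3 := by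
    omega
  exact_mod_cast this

lemma Sh_one_le (x : ℝ) : Sh 1 x ≤ Sh 0 x + 1 / 2 := by
  refine hasSum_le (fun ℓ => ?_) (Sh_summable 1 x).hasSum ((Sh_summable 0 x).hasSum.add (hasSum_geo 1))
  rw [← add_div]
  have h : (digit 3 x (ℓ + 1) + 1) % 3 ≤ (digit 3 x (ℓ + 1) + 0) % 3 + 1 := by omega
  have h' : (((digit 3 x (ℓ + 1) + 1) % 3 : ℕ) : ℝ) ≤ (((digit 3 x (ℓ + 1) + 0) % 3 : ℕ) : ℝ) + 1 := by
    exact_mod_cast h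
  gcongr

lemma Sh_lt_one (x : ℝ) (hx : x ∈ Ico (0:ℝ) 1) (h : x ≠ 1 / 2) : Sh 1 x < 1 := by
  refine lt_of_le_of_ne (Sh_le_one 1 x) fun h1 => h ?_
  have a := Sh_one_le x
  have b := Sh_sum x
  have c := Sh_nonneg 2 x
  rw [Sh_zero x hx] at a b
  linarith

/-- points whose expansion is not eventually equal to `1` -/
def Good (x : ℝ) : Prop := ∀ n : ℕ, Int.fract (3 ^ n * x) ≠ 1 / 2

lemma Good.fract {x : ℝ} (h : Good x) : Good (Int.fract (3 * x)) := by
  intro n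
  have e : (3:ℝ) ^ n * Int.fract (3 * x) = 3 ^ (n + 1) * x - ((3 ^ n * ⌊3 * x⌋ : ℤ) : ℝ) := by
    rw [Int.fract]; push_cast; ring
  rw [e, Int.fract_sub_intCast]
  exact h (n + 1)

lemma Good.lt {x : ℝ} (h : Good x) (hx : x ∈ Ico (0:ℝ) 1) : Sh 1 x < 1 := by
  refine Sh_lt_one x hx ?_
  have := h 0
  rwa [pow_zero, one_mul, Int.fract_eq_self.2 hx] at this

lemma digit_Sh (n : ℕ) : ∀ x ∈ Ico (0:ℝ) 1, Good x →
    digit 3 (Sh 1 x) (n + 1) = (digit 3 x (n + 1) + 1) % 3 := by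
  induction n with
  | zero =>
    intro x hx hg
    have hz := hg.fract.lt (fract_mem _)
    rw [Sh_rec 1 x hx.1, ← add_div]
    exact digit_one _ (Nat.mod_lt _ (by norm_num)) _ ⟨Sh_nonneg _ _, hz⟩
  | succ n ih =>
    intro x hx hg
    have hz := hg.fract.lt (fract_mem _)
    rw [← digit_fract _ (Sh_nonneg 1 x), ← digit_fract _ hx.1, ← ih _ (fract_mem _) hg.fract]
    congr 1
    rw [Sh_rec 1 x hx.1, ← add_div]
    exact fract_aff _ _ ⟨Sh_nonneg _ _, hz⟩

lemma Sh_Sh (x : ℝ) (hx : x ∈ Ico (0:ℝ) 1) (hg : Good x) : Sh 1 (Sh 1 x) = Sh 2 x := by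
  unfold Sh
  congr 1
  funext ℓ
  have := digit_Sh ℓ x hx hg
  unfold Sh at this
  rw [this]
  congr 2
  omega

lemma ae_good : ∀ᵐ x : ℝ, Good x := by
  have hc : ({x : ℝ | ¬ Good x}).Countable := by
    refine (countable_range (fun p : ℕ × ℤ => ((p.2 : ℝ) + 1 / 2) / 3 ^ p.1)).mono ?_
    intro x hx
    simp only [Good, mem_ofPred_eq, not_forall, not_not] at hx
    obtain ⟨n, hn⟩ := hx
    refine ⟨(n, ⌊3 ^ n * x⌋), ?_⟩
    simp only
    rw [← hn, Int.floor_add_fract]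
    field_simp
  exact hc.measure_zero _

lemma Sh_meas (j : ℕ) : Measurable (Sh j) := by
  unfold Sh
  refine Measurable.tsum fun ℓ => ?_
  refine Measurable.div_const ?_ _
  have h1 : Measurable (fun x : ℝ => ⌊x * ((3 : ℕ) : ℝ) ^ (ℓ + 1)⌋) :=
    (measurable_id.mul_const _).floor
  exact (measurable_from_top (f := fun z : ℤ => (((z.toNat % 3 + j) % 3 : ℕ) : ℝ))).comp h1

lemma II (g : ℝ → ℝ) (hg : Measurable g) (C a b : ℝ) (hC : ∀ x, |g x| ≤ C) :
    IntervalIntegrable g volume a b := by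
  rw [intervalIntegrable_iff]
  have : IsFiniteMeasure (volume.restrict (uIoc a b)) := by
    unfold uIoc; infer_instance
  exact Integrable.of_bound hg.aestronglyMeasurable C (ae_of_all _ hC)

lemma Sh_abs (j : ℕ) (x : ℝ) : |Sh j x| ≤ 1 := abs_le.2 ⟨by linarith [Sh_nonneg j x], Sh_le_one j x⟩

lemma Sh_int (j : ℕ) (a b : ℝ) : IntervalIntegrable (Sh j) volume a b :=
  II _ (Sh_meas j) 1 a b (Sh_abs j)

lemma Sh_int2 (j : ℕ) (a b : ℝ) : IntervalIntegrable (fun x => Sh j x ^ 2) volume a b :=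
  II _ ((Sh_meas j).pow_const 2) 1 a b fun x => by
    rw [abs_pow]; exact pow_le_one₀ (abs_nonneg _) (Sh_abs j x)

lemma integral_piece (g : ℝ → ℝ) (j k : ℕ) (hk : k < 3) :
    ∫ x in ((k:ℝ) / 3)..((k + 1 : ℝ) / 3), g (Sh j x) =
      1 / 3 * ∫ y in (0:ℝ)..1, g ((((k + j) % 3 : ℕ) : ℝ) / 3 + Sh j y / 3) := by
  have h := intervalIntegral.integral_comp_add_div (a := 0) (b := 1) (c := (3:ℝ))
    (fun x => g (Sh j x)) (by norm_num) ((k:ℝ) / 3)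
  have h2 : ∫ y in (0:ℝ)..1, g (Sh j ((k:ℝ) / 3 + y / 3))
      = ∫ y in (0:ℝ)..1, g ((((k + j) % 3 : ℕ) : ℝ) / 3 + Sh j y / 3) := by
    refine intervalIntegral.integral_congr_ae ?_
    have : ∀ᵐ y : ℝ, y ≠ 1 := by simp [ae_iff]
    filter_upwards [this] with y hy hm
    rw [uIoc_of_le zero_le_one] at hm
    rw [← add_div, Sh_aff j k hk y ⟨hm.1.le, lt_of_le_of_ne hm.2 hy⟩]
  rw [h2] at h
  rw [h, smul_eq_mul]
  rw [zero_div, add_zero, ← add_div]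
  ring

lemma int_lin (j : ℕ) (q : ℝ) : ∫ y in (0:ℝ)..1, (q / 3 + Sh j y / 3) =
    q / 3 + (∫ y in (0:ℝ)..1, Sh j y) / 3 := by
  rw [intervalIntegral.integral_add (by simp) ((Sh_int j 0 1).div_const 3),
    intervalIntegral.integral_div]
  simp

lemma int_sq (j : ℕ) (q : ℝ) : ∫ y in (0:ℝ)..1, (q / 3 + Sh j y / 3) ^ 2 =
    q ^ 2 / 9 + 2 * q / 9 * (∫ y in (0:ℝ)..1, Sh j y) + 1 / 9 * (∫ y in (0:ℝ)..1, Sh j y ^ 2) := by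
  have e : (fun y => (q / 3 + Sh j y / 3) ^ 2) =
    fun y => (q ^ 2 / 9 + 2 * q / 9 * Sh j y) + 1 / 9 * Sh j y ^ 2 := by funext y; ring
  rw [e, intervalIntegral.integral_add (by
      exact (intervalIntegrable_const).add ((Sh_int j 0 1).const_mul _)) ((Sh_int2 j 0 1).const_mul _),
    intervalIntegral.integral_add (by simp) ((Sh_int j 0 1).const_mul _),
    intervalIntegral.integral_const_mul, intervalIntegral.integral_const_mul]
  simp

lemma split3 (f : ℝ → ℝ) (hf : ∀ a b, IntervalIntegrable f volume a b) :
    ∫ x in (0:ℝ)..1, f x = (∫ x in (((0:ℕ):ℝ)/3)..((((0:ℕ):ℝ)+1)/3), f x)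
      + (∫ x in (((1:ℕ):ℝ)/3)..((((1:ℕ):ℝ)+1)/3), f x) + ∫ x in (((2:ℕ):ℝ)/3)..((((2:ℕ):ℝ)+1)/3), f x := by
  have h1 := intervalIntegral.integral_add_adjacent_intervals (hf 0 (1/3)) (hf (1/3) (2/3))
  have h2 := intervalIntegral.integral_add_adjacent_intervals (hf 0 (2/3)) (hf (2/3) 1)
  norm_num at h1 h2 ⊢
  linarith

lemma I1 (j : ℕ) : ∫ y in (0:ℝ)..1, Sh j y = 1 / 2 := by
  have h := split3 (Sh j) (Sh_int j)
  rw [integral_piece (fun t => t) j 0 (by norm_num), integral_piece (fun t => t) j 1 (by norm_num),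
    integral_piece (fun t => t) j 2 (by norm_num), int_lin, int_lin, int_lin] at h
  have hj : (0 + j) % 3 + (1 + j) % 3 + (2 + j) % 3 = 3 := by omega
  have hj' : (((0 + j) % 3 : ℕ) : ℝ) + (((1 + j) % 3 : ℕ) : ℝ) + (((2 + j) % 3 : ℕ) : ℝ) = 3 := by
    exact_mod_cast hj
  linarith

lemma I2 (j : ℕ) : ∫ y in (0:ℝ)..1, Sh j y ^ 2 = 1 / 3 := by
  have h := split3 (fun x => Sh j x ^ 2) (Sh_int2 j)
  rw [integral_piece (fun t => t ^ 2) j 0 (by norm_num), integral_piece (fun t => t ^ 2) j 1 (by norm_num),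
    integral_piece (fun t => t ^ 2) j 2 (by norm_num), int_sq, int_sq, int_sq, I1] at h
  have hj : (0 + j) % 3 + (1 + j) % 3 + (2 + j) % 3 = 3 := by omega
  have hj' : (((0 + j) % 3 : ℕ) : ℝ) + (((1 + j) % 3 : ℕ) : ℝ) + (((2 + j) % 3 : ℕ) : ℝ) = 3 := by
    exact_mod_cast hj
  have hq : ((0 + j) % 3) ^ 2 + ((1 + j) % 3) ^ 2 + ((2 + j) % 3) ^ 2 = 5 := by
    have : j % 3 < 3 := Nat.mod_lt _ (by norm_num)
    rw [Nat.add_mod 0, Nat.add_mod 1, Nat.add_mod 2]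
    interval_cases j % 3 <;> rfl
  have hq' : (((0 + j) % 3 : ℕ) : ℝ) ^ 2 + (((1 + j) % 3 : ℕ) : ℝ) ^ 2 + (((2 + j) % 3 : ℕ) : ℝ) ^ 2 = 5 := by
    exact_mod_cast hq
  linarith

lemma I2third (j : ℕ) (hj : j < 3) :
    ∫ y in (0:ℝ)..(1/3), Sh j y ^ 2 = 1 / 3 * ((j:ℝ) ^ 2 / 9 + j / 9 + 1 / 27) := by
  have h := integral_piece (fun t => t ^ 2) j 0 (by norm_num)
  rw [int_sq, I1, I2, zero_add, Nat.mod_eq_of_lt hj] at h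
  norm_num at h ⊢
  rw [h]; ring

/-- region of positive, pairwise distinct radii -/
def Dreg : Set (ℝ × ℝ × ℝ) :=
  {r | (0 < r.1 ∧ 0 < r.2.1 ∧ 0 < r.2.2) ∧ (r.1 ≠ r.2.1 ∧ r.1 ≠ r.2.2 ∧ r.2.1 ≠ r.2.2)}

lemma Dreg_open : IsOpen Dreg := by
  have h1 : Continuous fun r : ℝ × ℝ × ℝ => r.1 := by fun_prop
  have h2 : Continuous fun r : ℝ × ℝ × ℝ => r.2.1 := by fun_prop
  have h3 : Continuous fun r : ℝ × ℝ × ℝ => r.2.2 := by fun_prop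
  exact ((isOpen_lt continuous_const h1).inter ((isOpen_lt continuous_const h2).inter
    (isOpen_lt continuous_const h3))).inter ((isOpen_ne_fun h1 h2).inter
      ((isOpen_ne_fun h1 h3).inter (isOpen_ne_fun h2 h3)))

lemma ne_of_norm {r s : ℝ} {u v : EuclideanSpace ℝ (Fin 3)} (hu : ‖r • u‖ = r) (hv : ‖s • v‖ = s)
    (h : r ≠ s) : ‖r • u - s • v‖ ≠ 0 := by
  intro h0
  rw [norm_eq_zero, sub_eq_zero] at h0
  rw [h0] at hu
  exact h (hu.symm.trans hv)

lemma V3_lt (r₁ r₂ r₃ c : ℝ) (h1 : 0 ≤ r₁) (h2 : 0 ≤ r₂) (h3 : 0 ≤ r₃) (h : V3 r₁ r₂ r₃ < c) :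
    ∃ x y z : EuclideanSpace ℝ (Fin 3), ‖x‖ = r₁ ∧ ‖y‖ = r₂ ∧ ‖z‖ = r₃ ∧
      1 / ‖x - y‖ + 1 / ‖x - z‖ + 1 / ‖y - z‖ < c := by
  have hn : {e : ℝ | ∃ x₁ x₂ x₃ : EuclideanSpace ℝ (Fin 3),
    ‖x₁‖ = r₁ ∧ ‖x₂‖ = r₂ ∧ ‖x₃‖ = r₃ ∧
    e = 1 / ‖x₁ - x₂‖ + 1 / ‖x₁ - x₃‖ + 1 / ‖x₂ - x₃‖}.Nonempty := by
    obtain ⟨x, hx⟩ := exists_norm r₁ h1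
    obtain ⟨y, hy⟩ := exists_norm r₂ h2
    obtain ⟨z, hz⟩ := exists_norm r₃ h3
    exact ⟨_, x, y, z, hx, hy, hz, rfl⟩
  unfold V3 at h
  obtain ⟨e, ⟨x, y, z, hx, hy, hz, rfl⟩, he⟩ := exists_lt_of_csInf_lt hn h
  exact ⟨x, y, z, hx, hy, hz, he⟩

lemma sublevel_open (c : ℝ) : IsOpen (Dreg ∩ {r | V3 r.1 r.2.1 r.2.2 < c}) := by
  rw [isOpen_iff_mem_nhds]
  rintro r ⟨hr, hc⟩
  obtain ⟨⟨p1, p2, p3⟩, n12, n13, n23⟩ := hr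
  have hD : ∀ᶠ r' in 𝓝 r, r' ∈ Dreg := Dreg_open.mem_nhds ⟨⟨p1, p2, p3⟩, n12, n13, n23⟩
  obtain ⟨x, y, z, hx, hy, hz, he⟩ := V3_lt _ _ _ c p1.le p2.le p3.le hc
  obtain ⟨u, hu, rfl⟩ : ∃ u : EuclideanSpace ℝ (Fin 3), ‖u‖ = 1 ∧ x = r.1 • u :=
    ⟨r.1⁻¹ • x, by rw [norm_smul, hx, Real.norm_of_nonneg (by positivity)]; field_simp,
      by rw [smul_inv_smul₀ p1.ne']⟩
  obtain ⟨v, hv, rfl⟩ : ∃ u : EuclideanSpace ℝ (Fin 3), ‖u‖ = 1 ∧ y = r.2.1 • u :=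
    ⟨r.2.1⁻¹ • y, by rw [norm_smul, hy, Real.norm_of_nonneg (by positivity)]; field_simp,
      by rw [smul_inv_smul₀ p2.ne']⟩
  obtain ⟨w, hw, rfl⟩ : ∃ u : EuclideanSpace ℝ (Fin 3), ‖u‖ = 1 ∧ z = r.2.2 • u :=
    ⟨r.2.2⁻¹ • z, by rw [norm_smul, hz, Real.norm_of_nonneg (by positivity)]; field_simp,
      by rw [smul_inv_smul₀ p3.ne']⟩
  have d12 := ne_of_norm hx hy n12
  have d13 := ne_of_norm hx hz n13
  have d23 := ne_of_norm hy hz n23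
  have hcont : ContinuousAt (fun r' : ℝ × ℝ × ℝ => 1 / ‖r'.1 • u - r'.2.1 • v‖
      + 1 / ‖r'.1 • u - r'.2.2 • w‖ + 1 / ‖r'.2.1 • v - r'.2.2 • w‖) r := by
    refine ContinuousAt.add (ContinuousAt.add ?_ ?_) ?_
    · exact continuousAt_const.div (by fun_prop) d12
    · exact continuousAt_const.div (by fun_prop) d13
    · exact continuousAt_const.div (by fun_prop) d23
  filter_upwards [hD, hcont.eventually_lt_const he] with r' hr' hlt
  refine ⟨hr', lt_of_le_of_lt ?_ hlt⟩
  obtain ⟨⟨q1, q2, q3⟩, -⟩ := hr'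
  have nn : ∀ (t : ℝ) (u : EuclideanSpace ℝ (Fin 3)), 0 < t → ‖u‖ = 1 → ‖t • u‖ = t := by
    intro t u ht hu
    rw [norm_smul, hu, Real.norm_of_nonneg ht.le, mul_one]
  exact csInf_le (V3_bdd _ _ _) ⟨_, _, _, nn _ u q1 hu, nn _ v q2 hv, nn _ w q3 hw, rfl⟩

open Classical in
noncomputable def W (r : ℝ × ℝ × ℝ) : ℝ := if r ∈ Dreg then V3 r.1 r.2.1 r.2.2 else 0

lemma W_meas : Measurable W := by
  refine measurable_of_Iio fun c => ?_
  have e : W ⁻¹' Iio c = (Dreg ∩ {r | V3 r.1 r.2.1 r.2.2 < c}) ∪ (Dregᶜ ∩ {_r | 0 < c}) := by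
    ext r
    by_cases h : r ∈ Dreg <;> simp [W, h]
  rw [e]
  exact (sublevel_open c).measurableSet.union
    (Dreg_open.measurableSet.compl.inter (MeasurableSet.const _))

lemma energy (ε B : ℝ) (he : 0 < ε) (α β γ : ℝ → ℝ) (hα : Measurable α)
    (hβ : Measurable β) (hγ : Measurable γ)
    (hP : IntervalIntegrable (fun x => P ε (α x) (β x) (γ x)) volume 0 (1/3))
    (hD : ∀ᵐ x : ℝ, x ∈ Ioc (0:ℝ) (1/3) → (0 ≤ α x ∧ 0 ≤ β x ∧ 0 ≤ γ x) ∧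
      α x ≠ β x ∧ α x ≠ γ x ∧ β x ≠ γ x)
    (hb : ∀ᵐ x : ℝ, x ∈ Ioc (0:ℝ) (1/3) →
      |V3 (1 + ε * α x) (1 + ε * β x) (1 + ε * γ x) - P ε (α x) (β x) (γ x)| ≤ B) :
    |(∫ x in (0:ℝ)..(1/3), V3 (1 + ε * α x) (1 + ε * β x) (1 + ε * γ x))
      - ∫ x in (0:ℝ)..(1/3), P ε (α x) (β x) (γ x)| ≤ B * (1 / 3) := by
  have hI : IntervalIntegrable (fun x => V3 (1 + ε * α x) (1 + ε * β x) (1 + ε * γ x)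
      - P ε (α x) (β x) (γ x)) volume 0 (1/3) := by
    rw [intervalIntegrable_iff_integrableOn_Ioc_of_le (by norm_num)]
    have hP' := (intervalIntegrable_iff_integrableOn_Ioc_of_le (by norm_num)).1 hP
    refine Integrable.of_bound (C := B) (AEStronglyMeasurable.sub ?_ hP'.aestronglyMeasurable) ?_
    · have hm : Measurable fun x => W (1 + ε * α x, 1 + ε * β x, 1 + ε * γ x) :=
        W_meas.comp (by fun_prop)
      refine hm.aestronglyMeasurable.congr ?_
      rw [EventuallyEq, ae_restrict_iff' measurableSet_Ioc]
      filter_upwards [hD] with x hx hxm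
      obtain ⟨⟨a1, a2, a3⟩, n1, n2, n3⟩ := hx hxm
      have nd : ∀ x y : ℝ, x ≠ y → 1 + ε * x ≠ 1 + ε * y := fun x y hxy hh =>
        hxy (mul_left_cancel₀ he.ne' (add_left_cancel hh))
      have : (1 + ε * α x, 1 + ε * β x, 1 + ε * γ x) ∈ Dreg :=
        ⟨⟨by positivity, by positivity, by positivity⟩, nd _ _ n1, nd _ _ n2, nd _ _ n3⟩
      simp [W, this]
    · rw [ae_restrict_iff' measurableSet_Ioc]
      exact hb
  have hV : IntervalIntegrable (fun x => V3 (1 + ε * α x) (1 + ε * β x) (1 + ε * γ x))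
      volume 0 (1/3) := by simpa using hI.add hP
  rw [← intervalIntegral.integral_sub hV hP]
  have := intervalIntegral.norm_integral_le_of_norm_le_const_ae (a := 0) (b := 1/3) (C := B)
    (f := fun x => V3 (1 + ε * α x) (1 + ε * β x) (1 + ε * γ x)
      - P ε (α x) (β x) (γ x)) (by rw [uIoc_of_le (by norm_num)]; exact hb)
  simpa using this

lemma int_quad (c0 c1 c2 : ℝ) : ∫ x in (0:ℝ)..(1/3), (c0 + c1 * x + c2 * x ^ 2)
    = c0 / 3 + c1 / 18 + c2 / 81 := by
  rw [intervalIntegral.integral_add (by apply Continuous.intervalIntegrable; fun_prop)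
      (by apply Continuous.intervalIntegrable; fun_prop),
    intervalIntegral.integral_add (by apply Continuous.intervalIntegrable; fun_prop)
      (by apply Continuous.intervalIntegrable; fun_prop),
    intervalIntegral.integral_const_mul, intervalIntegral.integral_const_mul, integral_id, integral_pow]
  simp
  ring

lemma int_PG (ε : ℝ) : ∫ x in (0:ℝ)..(1/3), P ε x (2/3 - x) (2/3 + x) =
    1 / √3 * (1 - ε / 2 + ε ^ 2 * (1 / 30 + 61 / 270)) := by
  have e : (fun x => P ε x (2/3 - x) (2/3 + x)) = fun x => 1 / √3 *
      ((3 - 4 / 3 * ε + ε ^ 2 * (8 / 90 + 48 / 90)) + (-ε + ε ^ 2 * (8 / 10)) * x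
        + (ε ^ 2 * (6 / 10)) * x ^ 2) := by
    funext x; unfold P; ring
  rw [e, intervalIntegral.integral_const_mul, int_quad]
  ring

lemma PF_eq (ε x : ℝ) : P ε (Sh 0 x) (Sh 1 x) (Sh 2 x) =
    1 / √3 * ((3 - ε * (3 / 2) + ε ^ 2 * (27 / 40)) + ε ^ 2 / 10 * (Sh 0 x ^ 2 + Sh 1 x ^ 2 + Sh 2 x ^ 2)) := by
  unfold P; rw [Sh_sum]; ring

lemma int_PF (ε : ℝ) : ∫ x in (0:ℝ)..(1/3), P ε (Sh 0 x) (Sh 1 x) (Sh 2 x) =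
    1 / √3 * (1 - ε / 2 + ε ^ 2 * (1 / 30 + 9 / 40)) := by
  simp only [PF_eq]
  rw [intervalIntegral.integral_const_mul, intervalIntegral.integral_add (by simp)
    ((((Sh_int2 0 _ _).add (Sh_int2 1 _ _)).add (Sh_int2 2 _ _)).const_mul _),
    intervalIntegral.integral_const_mul,
    intervalIntegral.integral_add ((Sh_int2 0 _ _).add (Sh_int2 1 _ _)) (Sh_int2 2 _ _),
    intervalIntegral.integral_add (Sh_int2 0 _ _) (Sh_int2 1 _ _),
    I2third 0 (by norm_num), I2third 1 (by norm_num), I2third 2 (by norm_num)]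
  simp
  ring

lemma PF_int (ε : ℝ) :
    IntervalIntegrable (fun x => P ε (Sh 0 x) (Sh 1 x) (Sh 2 x)) volume 0 (1/3) := by
  simp only [PF_eq]
  exact (intervalIntegrable_const.add
    ((((Sh_int2 0 _ _).add (Sh_int2 1 _ _)).add (Sh_int2 2 _ _)).const_mul _)).const_mul _

lemma ae_F : ∀ᵐ x : ℝ, x ∈ Ioc (0:ℝ) (1/3) → Sh 0 x = x ∧ shiftMap 3 (shiftMap 3 x) = Sh 2 x ∧
    Sh 0 x ≠ Sh 1 x ∧ Sh 0 x ≠ Sh 2 x ∧ Sh 1 x ≠ Sh 2 x := by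
  have h3 : ∀ᵐ x : ℝ, x ≠ 1 / 3 := by simp [ae_iff]
  filter_upwards [ae_good, h3] with x hg hx hm
  have hlt : x < 1 / 3 := lt_of_le_of_ne hm.2 hx
  have hI : x ∈ Ico (0:ℝ) 1 := ⟨hm.1.le, by linarith⟩
  have h0 := Sh_zero x hI
  have hy : 3 * x ∈ Ico (0:ℝ) 1 := ⟨by linarith [hm.1], by linarith⟩
  have hxe : x = (((0:ℕ):ℝ) + 3 * x) / 3 := by push_cast; ring
  have hf : Int.fract (3 * x) = 3 * x := Int.fract_eq_self.2 hy
  have h1 : Sh 1 x = 1 / 3 + Sh 1 (3 * x) / 3 := by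
    conv_lhs => rw [hxe]
    rw [Sh_aff 1 0 (by norm_num) _ hy]; norm_num
  have h2 : Sh 2 x = 2 / 3 + Sh 2 (3 * x) / 3 := by
    conv_lhs => rw [hxe]
    rw [Sh_aff 2 0 (by norm_num) _ hy]; norm_num
  have l1 : Sh 1 (3 * x) < 1 := by
    have := hg.fract.lt (fract_mem _); rwa [hf] at this
  have n1 := Sh_nonneg 1 (3 * x)
  have n2 := Sh_nonneg 2 (3 * x)
  refine ⟨h0, ?_, ?_, ?_, ?_⟩
  · rw [shift_eq, shift_eq, Sh_Sh x hI hg]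
  · rw [h0]; exact ne_of_lt (by linarith)
  · rw [h0]; exact ne_of_lt (by linarith)
  · exact ne_of_lt (by linarith)

lemma F_eq (ε : ℝ) : Ffrc ε =
    3 * ∫ x in (0:ℝ)..(1/3), V3 (1 + ε * Sh 0 x) (1 + ε * Sh 1 x) (1 + ε * Sh 2 x) := by
  unfold Ffrc
  congr 1
  refine intervalIntegral.integral_congr_ae ?_
  rw [uIoc_of_le (by norm_num)]
  filter_upwards [ae_F] with x hx hm
  obtain ⟨h0, h2, -⟩ := hx hm
  rw [h0, h2, shift_eq]

lemma main1 : ∃ C δ : ℝ, 0 < C ∧ 0 < δ ∧ ∀ ε : ℝ, 0 < ε → ε < δ →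
      |(Ffrc ε - Gsgs ε) + Real.sqrt 3 / 1080 * ε ^ 2| ≤ C * ε ^ 3 := by
  obtain ⟨K, δ, hK, hδ, h⟩ := V3_expand
  refine ⟨2 * K, δ, by positivity, hδ, fun ε he hlt => ?_⟩
  have hF := energy ε (K * ε ^ 3) he (Sh 0) (Sh 1) (Sh 2) (Sh_meas 0) (Sh_meas 1) (Sh_meas 2) (PF_int ε)
    (by
      filter_upwards [ae_F] with x hx hm
      exact ⟨⟨Sh_nonneg _ _, Sh_nonneg _ _, Sh_nonneg _ _⟩, (hx hm).2.2⟩)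
    (by
      filter_upwards [ae_F] with x hx hm
      obtain ⟨-, -, a, b, c⟩ := hx hm
      exact h ε _ _ _ he hlt ⟨Sh_nonneg _ _, Sh_le_one _ _⟩ ⟨Sh_nonneg _ _, Sh_le_one _ _⟩
        ⟨Sh_nonneg _ _, Sh_le_one _ _⟩ a b c)
  have h3 : ∀ᵐ x : ℝ, x ≠ 1 / 3 := by simp [ae_iff]
  have hG := energy ε (K * ε ^ 3) he (fun x => x) (fun x => 2/3 - x) (fun x => 2/3 + x)
    measurable_id (by fun_prop) (by fun_prop)
    (by apply Continuous.intervalIntegrable; unfold P; fun_prop)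
    (by
      filter_upwards [h3] with x hx hm
      have hl : x < 1 / 3 := lt_of_le_of_ne hm.2 hx
      have := hm.1
      exact ⟨⟨by linarith, by linarith, by linarith⟩, ne_of_lt (by linarith), ne_of_lt (by linarith),
        ne_of_lt (by linarith)⟩)
    (by
      filter_upwards [h3] with x hx hm
      have hl : x < 1 / 3 := lt_of_le_of_ne hm.2 hx
      have := hm.1
      exact h ε _ _ _ he hlt ⟨by linarith, by linarith⟩ ⟨by linarith, by linarith⟩
        ⟨by linarith, by linarith⟩ (ne_of_lt (by linarith)) (ne_of_lt (by linarith))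
        (ne_of_lt (by linarith)))
  rw [int_PF] at hF
  rw [int_PG] at hG
  rw [F_eq, Gsgs]
  have hs : 1 / √3 = √3 / 3 := by
    rw [div_eq_div_iff (by positivity) (by norm_num)]
    have : √3 * √3 = 3 := Real.mul_self_sqrt (by norm_num)
    linarith
  rw [hs] at hF hG
  rw [abs_le] at *
  constructor <;> linarith [hF.1, hF.2, hG.1, hG.2]

end FRC

/-- **The fractal maps beat the SGS maps for thin shells:**
`F(ε) − G(ε) = −(√3/1080)ε² + O(ε³)` as `ε → 0⁺`; in particular
`F(ε) < G(ε)` for all sufficiently small `ε > 0`, so the SGS co-motion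
functions are not optimal for the shell density `ρ_{a,ε}`. -/
theorem frc_beats_sgs :
    (∃ C δ : ℝ, 0 < C ∧ 0 < δ ∧ ∀ ε : ℝ, 0 < ε → ε < δ →
      |(Ffrc ε - Gsgs ε) + Real.sqrt 3 / 1080 * ε ^ 2| ≤ C * ε ^ 3) ∧
    ∃ δ : ℝ, 0 < δ ∧ ∀ ε : ℝ, 0 < ε → ε < δ → Ffrc ε < Gsgs ε := by
  refine ⟨FRC.main1, ?_⟩
  obtain ⟨C, δ, hC, hδ, h⟩ := FRC.main1
  refine ⟨min δ (Real.sqrt 3 / 1080 / C), by positivity, fun ε he hlt => ?_⟩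
  have h1 := (abs_le.1 (h ε he (lt_of_lt_of_le hlt (min_le_left _ _)))).2
  have h2 : ε < Real.sqrt 3 / 1080 / C := lt_of_lt_of_le hlt (min_le_right _ _)
  rw [lt_div_iff₀ hC] at h2
  have h3 : 0 < ε ^ 2 := by positivity
  nlinarith
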